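/- Let α, β, γ ∈ F_q with α + β + γ = 0 and γ ≠ 0, and let A ⊆ F_q^n be such that αa_1 + βa_2 + γa_3 = 0 with a_1,a_2,a_3 ∈ A implies a_1 = a_2 = a_3. Then |A| ≤ 3·m_{(q-1)n/3}, where m_d is the number of monomials in x_1,...,x_n of total degree at most d with each variable of degree at most q-1. -/

import Mathlib

open Module in
/-- A subspace of `ι → K` contains a vector whose support has at least `finrank` elements. -/
theorem Submodule.exists_finrank_le_card_support {K ι : Type*} [Field K] [Fintype ι]
    [DecidableEq K] (V : Submodule K (ι → K)) :
    ∃ h ∈ V, finrank K V ≤ Fintype.card {i // h i ≠ 0} := by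
  let sizes : Set ℕ := {N | ∃ h ∈ V, Fintype.card {i // h i ≠ 0} = N}
  have hbdd : BddAbove sizes := ⟨Fintype.card ι, by
    rintro _ ⟨h, -, rfl⟩
    exact Fintype.card_subtype_le _⟩
  obtain ⟨h, hV, hN⟩ : sSup sizes ∈ sizes := Nat.sSup_mem ⟨_, 0, V.zero_mem, rfl⟩ hbdd
  refine ⟨h, hV, ?_⟩
  by_contra! hlt
  let res : V →ₗ[K] ({i // h i ≠ 0} → K) := (LinearMap.funLeft K K Subtype.val) ∘ₗ V.subtype
  obtain ⟨g, hg, hg0⟩ : ∃ g ∈ LinearMap.ker res, g ≠ 0 := by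
    refine (Submodule.ne_bot_iff _).1 (LinearMap.ker_ne_bot_of_finrank_lt ?_)
    simpa using hlt
  have hgz : ∀ i, h i ≠ 0 → g.1 i = 0 := fun i hi =>
    congrFun (LinearMap.mem_ker.1 hg) ⟨i, hi⟩
  obtain ⟨j, hj⟩ : ∃ j, g.1 j ≠ 0 := by
    by_contra! hz
    exact hg0 (Subtype.ext (funext hz))
  refine (le_csSup hbdd ⟨h + g.1, V.add_mem hV g.2, rfl⟩).not_gt ?_
  rw [← hN]
  rw [Fintype.card_subtype, Fintype.card_subtype]
  refine Finset.card_lt_card (Finset.ssubset_iff_of_subset ?_ |>.2 ⟨j, ?_, ?_⟩)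
  · intro i hi
    have hi' : h i ≠ 0 := by simpa using hi
    simpa [hgz i hi'] using hi'
  · have : h j = 0 := by_contra fun hh => hj (hgz j hh)
    simpa [this] using hj
  · simpa using fun hh => hj (hgz j hh)

open Module in
/-- The slice rank of the diagonal tensor on `ι × ι × ι` is at least the cardinality of `ι`. -/
theorem card_le_of_diagonal_eq_sum_slices {K ι I J L : Type*} [Field K] [Fintype ι]
    [DecidableEq ι] [Fintype I] [Fintype J] [Fintype L]
    (f₁ : I → ι → K) (g₁ : I → ι → ι → K) (f₂ : J → ι → K) (g₂ : J → ι → ι → K)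
    (f₃ : L → ι → K) (g₃ : L → ι → ι → K)
    (hT : ∀ x y z, (if x = y ∧ y = z then (1 : K) else 0) =
      ∑ i, f₁ i x * g₁ i y z + ∑ j, f₂ j y * g₂ j x z + ∑ l, f₃ l z * g₃ l x y) :
    Fintype.card ι ≤ Fintype.card I + Fintype.card J + Fintype.card L := by
  classical
  let M : Matrix I ι K := Matrix.of f₁
  obtain ⟨h, hV, hcard⟩ := (LinearMap.ker M.mulVecLin).exists_finrank_le_card_support
  have hdim := LinearMap.finrank_range_add_finrank_ker M.mulVecLin
  have hrange : finrank K (LinearMap.range M.mulVecLin) ≤ Fintype.card I :=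
    (Submodule.finrank_le _).trans (by simp)
  rw [finrank_fintype_fun_eq_card] at hdim
  have hM : ∀ i, ∑ x, f₁ i x * h x = 0 := fun i => congrFun (LinearMap.mem_ker.1 hV) i
  have hdiag : Matrix.diagonal h =
      Matrix.fromCols (Matrix.of fun y j => f₂ j y) (Matrix.of fun y l => ∑ x, h x * g₃ l x y) *
      Matrix.fromRows (Matrix.of fun j z => ∑ x, h x * g₂ j x z) (Matrix.of f₃) := by
    rw [Matrix.fromCols_mul_fromRows]
    ext y z
    have hsum : ∑ x, h x * (if x = y ∧ y = z then (1 : K) else 0) =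
        Matrix.diagonal h y z := by
      rw [Finset.sum_eq_single y]
      · simp [Matrix.diagonal_apply]
      · intro x _ hx
        simp [hx]
      · simp
    have hfirst : ∑ x, h x * ∑ i, f₁ i x * g₁ i y z = 0 := by
      simp_rw [Finset.mul_sum]
      rw [Finset.sum_comm]
      refine Finset.sum_eq_zero fun i _ => ?_
      rw [← zero_mul (g₁ i y z), ← hM i, Finset.sum_mul]
      exact Finset.sum_congr rfl fun x _ => by ring
    rw [← hsum]
    simp_rw [hT, mul_add]
    rw [Finset.sum_add_distrib, Finset.sum_add_distrib, hfirst, zero_add]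
    simp only [Matrix.add_apply, Matrix.mul_apply, Matrix.of_apply, Finset.mul_sum,
      Finset.sum_mul]
    congr 1
    · rw [Finset.sum_comm]
      exact Finset.sum_congr rfl fun j _ => Finset.sum_congr rfl fun x _ => by ring
    · rw [Finset.sum_comm]
      exact Finset.sum_congr rfl fun j _ => Finset.sum_congr rfl fun x _ => by ring
  have hrank : Fintype.card {i // h i ≠ 0} ≤ Fintype.card J + Fintype.card L := by
    rw [← Matrix.rank_diagonal, hdiag, ← Fintype.card_sum]
    exact (Matrix.rank_mul_le_left _ _).trans (Matrix.rank_le_card_width _)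
  omega

open Finset in
/-- A function `1 - (∑ j, w j * v j) ^ N` is a combination of monomials of degree at most `N`. -/
theorem exists_one_sub_sum_pow_eq {K κ : Type*} [CommRing K] [Fintype κ] [DecidableEq κ]
    (w : κ → K) (N : ℕ) :
    ∃ (S : Finset (κ → ℕ)) (c : (κ → ℕ) → K), (∀ k ∈ S, ∑ j, k j ≤ N) ∧
      ∀ v : κ → K, 1 - (∑ j, w j * v j) ^ N = ∑ k ∈ S, c k * ∏ j, v j ^ k j := by
  refine ⟨insert 0 (piAntidiag univ N), fun k => (if k = 0 then 1 else 0) -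
    if k ∈ piAntidiag univ N then Nat.multinomial univ k * ∏ j, w j ^ k j else 0, ?_, ?_⟩
  · intro k hk
    rcases Finset.mem_insert.1 hk with rfl | hk
    · simp
    · exact (Finset.mem_piAntidiag.1 hk).1.le
  · intro v
    simp_rw [sub_mul, Finset.sum_sub_distrib, ite_mul, zero_mul]
    rw [← Finset.sum_filter, ← Finset.sum_filter, Finset.filter_mem_eq_inter,
      Finset.inter_eq_right.2 (Finset.subset_insert _ _), Finset.sum_pow_eq_sum_piAntidiag]
    congr 1
    · rw [Finset.filter_eq', if_pos (Finset.mem_insert_self _ _)]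
      simp
    · exact Finset.sum_congr rfl fun k _ => by
        simp_rw [mul_pow]
        rw [Finset.prod_mul_distrib, mul_assoc]

/-- A sum over `S` whose terms carry a factor `m (a p)` with `a p ∈ D` is a sum over `D`. -/
theorem Finset.sum_mul_eq_sum_coe_fiberwise {K P E : Type*} [CommSemiring K] [DecidableEq E]
    (S : Finset P) (D : Finset E) (a : P → E) (ha : ∀ p ∈ S, a p ∈ D) (m : E → K) (g : P → K) :
    ∑ p ∈ S, m (a p) * g p = ∑ d : D, m d * ∑ p ∈ S with a p = d, g p := by
  rw [Finset.sum_coe_sort D fun d => m d * ∑ p ∈ S with a p = d, g p,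
    ← Finset.sum_fiberwise_of_maps_to ha]
  refine Finset.sum_congr rfl fun d _ => ?_
  rw [Finset.mul_sum]
  exact Finset.sum_congr rfl fun p hp => by rw [(Finset.mem_filter.1 hp).2]

/-- Ellenberg–Gijswijt: if `α + β + γ = 0` with `γ ≠ 0` and `A ⊆ F_q^n` has no
nontrivial solutions to `α a₁ + β a₂ + γ a₃ = 0`, then
`|A| ≤ 3 * m_{(q-1)n/3}`, where `m_d` counts monomials in `n` variables of total
degree at most `d` with each exponent at most `q - 1`. -/
theorem stmt_9 (F : Type*) [Field F] [Fintype F] (n : ℕ) (hn : 0 < n)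
    (α β γ : F) (hsum : α + β + γ = 0) (hγ : γ ≠ 0) (A : Finset (Fin n → F))
    (hA : ∀ a₁ ∈ A, ∀ a₂ ∈ A, ∀ a₃ ∈ A, α • a₁ + β • a₂ + γ • a₃ = 0 →
      a₁ = a₂ ∧ a₂ = a₃) :
    A.card ≤ 3 * (Finset.univ.filter (fun m : Fin n → Fin (Fintype.card F) =>
      3 * ∑ i, (m i : ℕ) ≤ (Fintype.card F - 1) * n)).card := by
  classical
  set D := Finset.univ.filter (fun m : Fin n → Fin (Fintype.card F) =>
      3 * ∑ i, (m i : ℕ) ≤ (Fintype.card F - 1) * n) with hD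
  have hq : 1 < Fintype.card F := Fintype.one_lt_card
  obtain ⟨S, c, hS, hc⟩ := exists_one_sub_sum_pow_eq ![α, β, γ] (Fintype.card F - 1)
  let E : Finset (Fin n → ℕ) := D.image fun m i => (m i : ℕ)
  let P : Finset (Fin n → Fin 3 → ℕ) := Fintype.piFinset fun _ => S
  have hE : ∀ p ∈ P, ∀ j, 3 * ∑ i, p i j ≤ (Fintype.card F - 1) * n → (fun i => p i j) ∈ E := by
    intro p hp j hj
    have hlt : ∀ i, p i j < Fintype.card F := fun i => by
      have hle : p i j ≤ Fintype.card F - 1 :=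
        (Finset.single_le_sum (f := p i) (fun _ _ => Nat.zero_le _) (Finset.mem_univ j)).trans
          (hS _ (Fintype.mem_piFinset.1 hp i))
      omega
    exact Finset.mem_image.2 ⟨fun i => ⟨p i j, hlt i⟩, by simpa [hD] using hj, rfl⟩
  have hcover : ∀ p ∈ P, (fun i => p i 0) ∉ E → (fun i => p i 1) ∉ E → (fun i => p i 2) ∈ E := by
    intro p hp h₀ h₁
    refine hE p hp 2 ?_
    have h₀' := mt (hE p hp 0) h₀
    have h₁' := mt (hE p hp 1) h₁
    have htot : ∑ i, (p i 0 + p i 1 + p i 2) ≤ ∑ _i : Fin n, (Fintype.card F - 1) :=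
      Finset.sum_le_sum fun i _ => by
        simpa [Fin.sum_univ_three] using hS _ (Fintype.mem_piFinset.1 hp i)
    simp only [Finset.sum_add_distrib, Finset.sum_const, Finset.card_univ, Fintype.card_fin,
      smul_eq_mul] at htot
    rw [mul_comm n] at htot
    omega
  let mon : (Fin n → ℕ) → (Fin n → F) → F := fun d x => ∏ i, x i ^ d i
  let C : (Fin n → Fin 3 → ℕ) → F := fun p => ∏ i, c (p i)
  have hdiag : ∀ x y z : A, (if x = y ∧ y = z then (1 : F) else 0) =
      ∑ p ∈ P, C p * mon (fun i => p i 0) x * mon (fun i => p i 1) y * mon (fun i => p i 2) z := by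
    intro x y z
    have hexp : ∏ i, (1 - (α * x.1 i + β * y.1 i + γ * z.1 i) ^ (Fintype.card F - 1)) =
        ∑ p ∈ P, C p * mon (fun i => p i 0) x * mon (fun i => p i 1) y *
          mon (fun i => p i 2) z := by
      have hfac : ∀ i, 1 - (α * x.1 i + β * y.1 i + γ * z.1 i) ^ (Fintype.card F - 1) =
          ∑ k ∈ S, c k * (x.1 i ^ k 0 * y.1 i ^ k 1 * z.1 i ^ k 2) := fun i => by
        simpa [Fin.sum_univ_three, Fin.prod_univ_three] using hc ![x.1 i, y.1 i, z.1 i]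
      simp_rw [hfac]
      rw [Finset.prod_univ_sum]
      refine Finset.sum_congr rfl fun p _ => ?_
      simp only [C, mon, Finset.prod_mul_distrib]
      ring
    rw [← hexp]
    split_ifs with h
    · obtain ⟨rfl, rfl⟩ := h
      refine (Finset.prod_eq_one fun i _ => ?_).symm
      rw [← add_mul, ← add_mul, hsum, zero_mul, zero_pow (by omega), sub_zero]
    · obtain ⟨i, hi⟩ : ∃ i, α * x.1 i + β * y.1 i + γ * z.1 i ≠ 0 := by
        by_contra! hz
        obtain ⟨h₁, h₂⟩ := hA x x.2 y y.2 z z.2 (funext fun i => by simpa using hz i)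
        exact h ⟨Subtype.ext h₁, Subtype.ext h₂⟩
      refine (Finset.prod_eq_zero (Finset.mem_univ i) ?_).symm
      rw [FiniteField.pow_card_sub_one_eq_one _ hi, sub_self]
  let P₀ := P.filter fun p => (fun i => p i 0) ∈ E
  let Q := P.filter fun p => (fun i => p i 0) ∉ E
  let P₁ := Q.filter fun p => (fun i => p i 1) ∈ E
  let P₂ := Q.filter fun p => (fun i => p i 1) ∉ E
  have hP₂ : ∀ p ∈ P₂, (fun i => p i 2) ∈ E := fun p hp => by
    simp only [P₂, Q, Finset.mem_filter] at hp
    exact hcover p hp.1.1 hp.1.2 hp.2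
  have hslice := card_le_of_diagonal_eq_sum_slices (K := F) (ι := A) (I := E) (J := E) (L := E)
    (fun d x => mon d x)
    (fun d y z => ∑ p ∈ P₀ with (fun i => p i 0) = d.1,
      C p * mon (fun i => p i 1) y * mon (fun i => p i 2) z)
    (fun d y => mon d y)
    (fun d x z => ∑ p ∈ P₁ with (fun i => p i 1) = d.1,
      C p * mon (fun i => p i 0) x * mon (fun i => p i 2) z)
    (fun d z => mon d z)
    (fun d x y => ∑ p ∈ P₂ with (fun i => p i 2) = d.1,
      C p * mon (fun i => p i 0) x * mon (fun i => p i 1) y) ?_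
  · have hcard : E.card ≤ D.card := Finset.card_image_le
    simp only [Fintype.card_coe] at hslice
    omega
  · intro x y z
    rw [hdiag, ← Finset.sum_filter_add_sum_filter_not P fun p => (fun i => p i 0) ∈ E,
      ← Finset.sum_filter_add_sum_filter_not Q fun p => (fun i => p i 1) ∈ E, ← add_assoc,
      ← Finset.sum_mul_eq_sum_coe_fiberwise P₀ E (fun p i => p i 0)
        (fun p hp => (Finset.mem_filter.1 hp).2) (fun d => mon d x),
      ← Finset.sum_mul_eq_sum_coe_fiberwise P₁ E (fun p i => p i 1)
        (fun p hp => (Finset.mem_filter.1 hp).2) (fun d => mon d y),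
      ← Finset.sum_mul_eq_sum_coe_fiberwise P₂ E (fun p i => p i 2) hP₂ (fun d => mon d z)]
    congr 1
    · congr 1 <;> exact Finset.sum_congr rfl fun p _ => by ring
    · exact Finset.sum_congr rfl fun p _ => by ring
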